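/- For every pair of non-negative integers n and m, MO(11m+10; 11n+7) ≡ 0 (mod 11). (The case m = 0 is the conjecture of Amdeberhan–Andrews–Tauraso: MO(10; 11n+7) ≡ 0 (mod 11).) -/

import Mathlib

open Finset

/-- `MO a n` is MacMahon's coefficient: the sum of the products `s_1 ⋯ s_a` over all
strictly increasing tuples `0 < k_1 < ⋯ < k_a` of positive integers and positive
integers `s_1, …, s_a` with `s_1*k_1 + ⋯ + s_a*k_a = n` (all such data satisfy
`k_i, s_i ≤ n`, so we may sum over a finite set); in particular `MO a 0 = 0` for `a ≥ 1`. -/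
def MO (a n : ℕ) : ℕ :=
  ∑ f ∈ Finset.univ.filter (fun f : Fin a → Fin (n + 1) × Fin (n + 1) =>
      (∀ i, 0 < ((f i).1 : ℕ) ∧ 0 < ((f i).2 : ℕ)) ∧
      (∀ i j : Fin a, i < j → (f i).1 < (f j).1) ∧
      (∑ i, ((f i).2 : ℕ) * ((f i).1 : ℕ)) = n),
    ∏ i, ((f i).2 : ℕ)

/-- The finite `q`-Pochhammer product `(1 - q) (1 - q ^ 2) ⋯ (1 - q ^ n)`. -/
def qPoch {R : Type*} [CommRing R] (q : R) (n : ℕ) : R := ∏ i ∈ range n, (1 - q ^ (i + 1))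

section qPoch

variable {R : Type*} [CommRing R] (q : R)

@[simp]
theorem qPoch_zero : qPoch q 0 = 1 := by simp [qPoch]

theorem qPoch_succ (n : ℕ) : qPoch q (n + 1) = qPoch q n * (1 - q ^ (n + 1)) :=
  prod_range_succ _ _

theorem pow_dvd_qPoch_add_sub (n k : ℕ) : q ^ (n + 1) ∣ qPoch q (n + k) - qPoch q n := by
  induction k with
  | zero => simp
  | succ k ih =>
    have h : qPoch q (n + (k + 1)) - qPoch q n =
        qPoch q (n + k) - qPoch q n - q ^ (n + 1) * (q ^ k * qPoch q (n + k)) := by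
      rw [← add_assoc, qPoch_succ]; ring
    rw [h]
    exact dvd_sub ih (dvd_mul_right _ _)

/-- The coefficients of the finite triple product, see `prod_eq_sum_tripleCoeff`. -/
def tripleCoeff : ℕ → ℕ → R
  | 0, 0 => 1
  | 0, _ + 1 => 0
  | N + 1, 0 => (1 + q ^ (2 * N + 2) + q ^ (N + 1)) * tripleCoeff N 0 +
      q ^ (N + 1) * tripleCoeff N 1
  | N + 1, n + 1 => (1 + q ^ (2 * N + 2)) * tripleCoeff N (n + 1) +
      q ^ (N + 1) * (tripleCoeff N n + tripleCoeff N (n + 2))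

theorem tripleCoeff_eq_zero {N n : ℕ} (h : N < n) : tripleCoeff q N n = 0 := by
  induction N generalizing n with
  | zero => obtain _ | n := n <;> simp_all [tripleCoeff]
  | succ N ih =>
    obtain _ | n := n
    · omega
    · rw [tripleCoeff, ih (by omega), ih (by omega), ih (by omega)]; ring

/-- If `x = 2 - z - 1 / z`, then `chebyshevW n` is `z ^ (-n) + ⋯ + z ^ n`, as a polynomial
in `x`. -/
noncomputable def chebyshevW (R : Type*) [CommRing R] : ℕ → Polynomial R
  | 0 => 1
  | 1 => 3 - Polynomial.X
  | n + 2 => (2 - Polynomial.X) * chebyshevW R (n + 1) - chebyshevW R n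

open Polynomial in
/-- A finite form of the Jacobi triple product identity. -/
theorem prod_eq_sum_tripleCoeff (N : ℕ) :
    ∏ k ∈ range N, (C ((1 - q ^ (k + 1)) ^ 2) + C (q ^ (k + 1)) * X) =
      ∑ n ∈ range (N + 1), (-1) ^ n * C (tripleCoeff q N n) * chebyshevW R n := by
  induction N with
  | zero => simp [tripleCoeff, chebyshevW]
  | succ N ih =>
    have hW (n : ℕ) : (2 - X) * chebyshevW R (n + 1) = chebyshevW R (n + 2) + chebyshevW R n := by
      rw [chebyshevW]; ring
    have key (M : ℕ) : (∑ n ∈ range (M + 1), (-1) ^ n * C (tripleCoeff q N n) * chebyshevW R n) *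
          (C ((1 - q ^ (N + 1)) ^ 2) + C (q ^ (N + 1)) * X) =
        ∑ n ∈ range (M + 1), (-1) ^ n * C (tripleCoeff q (N + 1) n) * chebyshevW R n -
        (-1) ^ M * C (q ^ (N + 1)) * (C (tripleCoeff q N (M + 1)) * chebyshevW R M +
          C (tripleCoeff q N M) * chebyshevW R (M + 1)) := by
      induction M with
      | zero => simp [tripleCoeff, chebyshevW]; ring
      | succ M ihM =>
        rw [sum_range_succ, add_mul, ihM, sum_range_succ _ (M + 1), tripleCoeff]
        simp only [map_add, map_mul, map_pow, map_sub, map_one]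
        linear_combination (-1) ^ M * C q ^ (N + 1) * C (tripleCoeff q N (M + 1)) * hW M
    rw [prod_range_succ, ih, key, sum_range_succ _ (N + 1), tripleCoeff,
      tripleCoeff_eq_zero q (n := N + 1) (by omega), tripleCoeff_eq_zero q (n := N + 2) (by omega)]
    simp only [map_add, map_mul, map_pow, map_one, map_zero]
    ring

theorem coeff_chebyshevW (n a : ℕ) : (chebyshevW R n).coeff a =
    (-1) ^ a * (((n + a).choose (2 * a) + 2 * (n + a).choose (2 * a + 1) : ℕ) : R) := by
  induction n using Nat.twoStepInduction generalizing a with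
  | zero =>
    obtain _ | a := a
    · simp [chebyshevW]
    · rw [Nat.choose_eq_zero_of_lt (by omega), Nat.choose_eq_zero_of_lt (by omega)]
      simp [chebyshevW, Polynomial.coeff_one]
  | one =>
    obtain _ | _ | a := a
    · simp [chebyshevW]
    · simp [chebyshevW, Polynomial.coeff_X, Polynomial.coeff_ofNat_succ]
    · rw [Nat.choose_eq_zero_of_lt (by omega), Nat.choose_eq_zero_of_lt (by omega)]
      simp [chebyshevW, Polynomial.coeff_X, Polynomial.coeff_ofNat_succ]
  | more n ih ih' =>
    rw [chebyshevW, sub_mul]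
    obtain _ | a := a
    · simp [ih, ih', Polynomial.coeff_ofNat_mul]; ring
    · simp only [Polynomial.coeff_sub, Polynomial.coeff_ofNat_mul, Polynomial.coeff_X_mul, ih, ih']
      have e1 : n + 2 + (a + 1) = n + a + 1 + 1 + 1 := by ring
      have e2 : n + 1 + (a + 1) = n + a + 1 + 1 := by ring
      have e3 : 2 * (a + 1) = 2 * a + 1 + 1 := by ring
      have e4 : n + 1 + a = n + a + 1 := by ring
      have e5 : n + (a + 1) = n + a + 1 := by ring
      simp only [e1, e2, e3, e4, e5, Nat.choose_succ_succ', pow_succ]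
      push_cast
      ring

/-- The triangular numbers. -/
def tri (n : ℕ) : ℕ := n * (n + 1) / 2

theorem tri_succ (n : ℕ) : tri (n + 1) = tri n + (n + 1) := by
  unfold tri; grind

theorem tripleCoeff_mul_qPoch [IsDomain R] (hq : ∀ n, qPoch q n ≠ 0) (n j : ℕ) :
    tripleCoeff q (n + j) n * qPoch q j * qPoch q (2 * n + j + 1) =
      q ^ tri n * qPoch q (2 * n + 2 * j + 1) := by
  generalize hN : n + j = N
  induction N generalizing n j with
  | zero =>
    obtain ⟨rfl, rfl⟩ : n = 0 ∧ j = 0 := by omega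
    simp [tripleCoeff, tri]
  | succ N ih =>
    have hdiag : tripleCoeff q N N = q ^ tri N := by
      have := ih N 0 rfl
      simp only [mul_zero, add_zero, qPoch_zero, mul_one] at this
      exact mul_right_cancel₀ (hq _) this
    have hsucc (k : ℕ) := qPoch_succ q k
    obtain _ | n := n
    · obtain rfl : j = N + 1 := by omega
      have h0 := ih 0 N (by omega)
      obtain _ | N := N
      · simp [tripleCoeff, tri, qPoch_succ]; ring
      · have h1 := ih 1 N (by omega)
        rw [show 2 * 0 + N.succ + 1 = N + 2 by omega,
          show 2 * 0 + 2 * N.succ + 1 = 2 * N + 3 by omega] at h0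
        rw [show 2 * 1 + N + 1 = N + 3 by omega,
          show 2 * 1 + 2 * N + 1 = 2 * N + 3 by omega, tri_succ] at h1
        rw [show 2 * 0 + (N + 1 + 1) + 1 = N + 3 by omega,
          show 2 * 0 + 2 * (N + 1 + 1) + 1 = 2 * N + 5 by omega, tripleCoeff]
        simp only [hsucc] at h0 h1 ⊢
        linear_combination (1 + q ^ (2 * N + 4) + q ^ (N + 2)) * (1 - q ^ (N + 2)) *
          (1 - q ^ (N + 3)) * h0 + q ^ (N + 2) * (1 - q ^ (N + 1)) * (1 - q ^ (N + 2)) * h1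
    · obtain _ | _ | j := j
      · obtain rfl : n = N := by omega
        rw [tripleCoeff, hdiag, tripleCoeff_eq_zero q (n := n + 1) (by omega),
          tripleCoeff_eq_zero q (n := n + 2) (by omega), tri_succ, qPoch_zero]
        ring_nf
      · obtain rfl : n + 1 = N := by omega
        have h0 := ih n 1 rfl
        rw [tripleCoeff, hdiag, tripleCoeff_eq_zero q (n := n + 2) (by omega)]
        rw [show 2 * n + 1 + 1 = 2 * n + 2 by omega,
          show 2 * n + 2 * 1 + 1 = 2 * n + 3 by omega] at h0
        rw [show 2 * (n + 1) + (0 + 1) + 1 = 2 * n + 4 by omega, tri_succ,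
          show 2 * n + 4 + 1 = 2 * n + 5 by omega]
        simp only [hsucc, zero_add, qPoch_zero] at h0 ⊢
        linear_combination q ^ (n + 2) * (1 - q ^ (2 * n + 3)) * (1 - q ^ (2 * n + 4)) * h0
      · obtain rfl : n + (j + 2) = N := by omega
        have ha := ih (n + 1) (j + 1) (by omega)
        have hb := ih n (j + 2) (by omega)
        have hc := ih (n + 2) j (by omega)
        rw [show 2 * (n + 1) + (j + 1) + 1 = 2 * n + j + 4 by omega, tri_succ,
          show 2 * (n + 1) + 2 * (j + 1) + 1 = 2 * n + 2 * j + 5 by omega] at ha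
        rw [show 2 * n + (j + 2) + 1 = 2 * n + j + 3 by omega,
          show 2 * n + 2 * (j + 2) + 1 = 2 * n + 2 * j + 5 by omega] at hb
        rw [show 2 * (n + 2) + j + 1 = 2 * n + j + 5 by omega, tri_succ, tri_succ,
          show 2 * (n + 2) + 2 * j + 1 = 2 * n + 2 * j + 5 by omega] at hc
        rw [show 2 * (n + 1) + (j + 1 + 1) + 1 = 2 * n + j + 5 by omega, tri_succ, tripleCoeff,
          show 2 * (n + 1) + 2 * (j + 1 + 1) + 1 = 2 * n + 2 * j + 5 + 1 + 1 by omega,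
          hsucc (2 * n + 2 * j + 5 + 1), hsucc (2 * n + 2 * j + 5)]
        generalize qPoch q (2 * n + 2 * j + 5) = P at *
        simp only [hsucc] at ha hb hc ⊢
        linear_combination (1 + q ^ (2 * n + 2 * j + 6)) * (1 - q ^ (j + 2)) *
          (1 - q ^ (2 * n + j + 5)) * ha + q ^ (n + j + 3) * (1 - q ^ (2 * n + j + 4)) *
          (1 - q ^ (2 * n + j + 5)) * hb + q ^ (n + j + 3) * (1 - q ^ (j + 1)) *
          (1 - q ^ (j + 2)) * hc

theorem isCoprime_pow_qPoch (m n : ℕ) : IsCoprime (q ^ m) (qPoch q n) := by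
  refine IsCoprime.pow_left (IsCoprime.prod_right fun i _ ↦ ⟨q ^ i, 1, by ring⟩)

theorem pow_dvd_qPoch_mul_tripleCoeff_sub [IsDomain R] (hq : ∀ n, qPoch q n ≠ 0) {n N : ℕ}
    (h : n ≤ N) : q ^ (N + 1) ∣ qPoch q N * tripleCoeff q N n - q ^ tri n := by
  obtain ⟨j, rfl⟩ := Nat.exists_eq_add_of_le h
  have htri : n ≤ tri n := by
    clear h
    induction n with
    | zero => simp
    | succ n ih => rw [tri_succ]; omega
  obtain ⟨u, hu⟩ := pow_dvd_qPoch_add_sub q (2 * n + j + 1) j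
  obtain ⟨v, hv⟩ := pow_dvd_qPoch_add_sub q j n
  have key := tripleCoeff_mul_qPoch q hq n j
  rw [show 2 * n + 2 * j + 1 = 2 * n + j + 1 + j by omega] at key
  obtain ⟨w, hw⟩ : q ^ tri n ∣ tripleCoeff q (n + j) n := by
    refine (isCoprime_pow_qPoch q _ j).dvd_of_dvd_mul_right
      ((isCoprime_pow_qPoch q _ (2 * n + j + 1)).dvd_of_dvd_mul_right ?_)
    exact key ▸ dvd_mul_right _ _
  have h1 : q ^ (n + j + 1) ∣ qPoch q j * tripleCoeff q (n + j) n - q ^ tri n := by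
    refine (isCoprime_pow_qPoch q _ (2 * n + j + 1)).dvd_of_dvd_mul_right
      ⟨q ^ tri n * q ^ (n + 1) * u, ?_⟩
    linear_combination key + q ^ tri n * hu
  have h2 : q ^ (n + j + 1) ∣ q ^ (j + 1) * v * tripleCoeff q (n + j) n := by
    rw [hw, show q ^ (j + 1) * v * (q ^ tri n * w) = q ^ (tri n + j + 1) * (v * w) by ring]
    exact (pow_dvd_pow q (by omega)).mul_right _
  convert dvd_add h1 h2 using 1
  rw [add_comm n j]
  linear_combination tripleCoeff q (j + n) n * hv

end qPoch

section MacMahon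

open PowerSeries

/-- `∑ s ≤ N, s * X ^ (s * k)`, which agrees with `X ^ k / (1 - X ^ k) ^ 2` up to order `N`. -/
noncomputable def truncLambert (R : Type*) [CommRing R] (N k : ℕ) : R⟦X⟧ :=
  ∑ s ∈ range (N + 1), (s : R⟦X⟧) * X ^ (s * k)

/-- The truncation of MacMahon's series of index `a`. -/
noncomputable def truncMacMahon (R : Type*) [CommRing R] (N a : ℕ) : R⟦X⟧ :=
  ∑ t ∈ powersetCard a (Icc 1 N), ∏ k ∈ t, truncLambert R N k

variable {R : Type*} [CommRing R]

theorem X_pow_dvd_truncLambert_mul_sub {N k : ℕ} (hk : 1 ≤ k) :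
    (X : R⟦X⟧) ^ (N + 1) ∣ (1 - X ^ k) ^ 2 * truncLambert R N k - X ^ k := by
  have h (M : ℕ) : (1 - X ^ k) ^ 2 * truncLambert R M k - X ^ k =
      (X : R⟦X⟧) ^ (k * (M + 1)) * ((M : R⟦X⟧) * X ^ k - ((M : R⟦X⟧) + 1)) := by
    induction M with
    | zero => simp [truncLambert]
    | succ M ih =>
      rw [truncLambert, sum_range_succ, mul_add, add_sub_right_comm, ← truncLambert, ih]
      push_cast
      ring
  rw [h]
  exact (pow_dvd_pow _ (Nat.le_mul_of_pos_left _ hk)).mul_right _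

theorem dvd_prod_sub_prod {ι S : Type*} [CommRing S] {d : S} {f g : ι → S} {t : Finset ι}
    (h : ∀ i ∈ t, d ∣ f i - g i) : d ∣ ∏ i ∈ t, f i - ∏ i ∈ t, g i := by
  simp only [← Ideal.mem_span_singleton, ← Ideal.Quotient.eq, map_prod] at h ⊢
  exact prod_congr rfl h

theorem coeff_prod_C_add_C_mul_X {ι S : Type*} [CommRing S] [DecidableEq ι] (f g : ι → S)
    (s : Finset ι) (a : ℕ) :
    (∏ k ∈ s, (Polynomial.C (f k) + Polynomial.C (g k) * Polynomial.X)).coeff a =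
      ∑ t ∈ powersetCard a s, (∏ k ∈ t, g k) * ∏ k ∈ s \ t, f k := by
  simp_rw [add_comm (Polynomial.C (f _))]
  rw [prod_add, Polynomial.finsetSum_coeff, powersetCard_eq_filter, sum_filter]
  refine sum_congr rfl fun t _ ↦ ?_
  rw [prod_mul_distrib, prod_const, ← map_prod, ← map_prod, mul_right_comm, ← map_mul,
    Polynomial.coeff_C_mul_X_pow]
  simp only [eq_comm]

theorem prod_range_eq_prod_Icc {M : Type*} [CommMonoid M] (f : ℕ → M) (n : ℕ) :
    ∏ k ∈ range n, f (k + 1) = ∏ k ∈ Icc 1 n, f k := by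
  rw [range_eq_Ico, prod_Ico_add', zero_add, Ico_add_one_right_eq_Icc]

theorem X_pow_dvd_qPoch_sq_mul_truncMacMahon_sub (N a : ℕ) :
    (X : R⟦X⟧) ^ (N + 1) ∣ qPoch X N ^ 2 * truncMacMahon R N a -
      (∏ k ∈ range N, (Polynomial.C ((1 - (X : R⟦X⟧) ^ (k + 1)) ^ 2) +
        Polynomial.C (X ^ (k + 1)) * Polynomial.X)).coeff a := by
  rw [prod_range_eq_prod_Icc (fun k ↦ Polynomial.C ((1 - (X : R⟦X⟧) ^ k) ^ 2) +
    Polynomial.C (X ^ k) * Polynomial.X), coeff_prod_C_add_C_mul_X, qPoch,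
    prod_range_eq_prod_Icc (fun k ↦ 1 - (X : R⟦X⟧) ^ k), truncMacMahon, mul_sum, ← sum_sub_distrib]
  refine dvd_sum fun t ht ↦ ?_
  rw [mem_powersetCard] at ht
  rw [← prod_pow, ← prod_sdiff ht.1, mul_assoc, ← prod_mul_distrib, mul_comm (∏ k ∈ t, X ^ k),
    ← mul_sub]
  exact (dvd_prod_sub_prod fun k hk ↦
    X_pow_dvd_truncLambert_mul_sub (mem_Icc.1 (ht.1 hk)).1).mul_left _

theorem coeff_truncMacMahon (a n : ℕ) : coeff n (truncMacMahon R n a) = (MO a n : R) := by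
  have hsum : truncMacMahon R n a = ∑ k : Fin a → Fin (n + 1) with
      (∀ i, 0 < (k i : ℕ)) ∧ ∀ i j, i < j → k i < k j, ∏ i, truncLambert R n (k i) := by
    have hinj {k : Fin a → Fin (n + 1)} (hk : ∀ i j, i < j → k i < k j) :
        Function.Injective fun i ↦ (k i : ℕ) :=
      Fin.val_injective.comp (StrictMono.injective fun i j h ↦ hk i j h)
    symm
    refine sum_bij (fun k _ ↦ univ.image fun i ↦ (k i : ℕ)) ?_ ?_ ?_ ?_
    · intro k hk
      simp only [mem_filter, mem_univ, true_and] at hk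
      rw [mem_powersetCard, card_image_of_injective _ (hinj hk.2), card_univ, Fintype.card_fin]
      refine ⟨image_subset_iff.2 fun i _ ↦ mem_Icc.2 ⟨hk.1 i, by omega⟩, rfl⟩
    · intro k hk l hl h
      simp only [mem_filter, mem_univ, true_and] at hk hl
      have hcard : #(univ.image fun i ↦ (k i : ℕ)) = a := by
        rw [card_image_of_injective _ (hinj hk.2),
          card_univ, Fintype.card_fin]
      have h1 := orderEmbOfFin_unique hcard (f := fun i ↦ (k i : ℕ)) (by simp) hk.2
      have h2 := orderEmbOfFin_unique hcard (f := fun i ↦ (l i : ℕ)) (by simp [h]) hl.2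
      funext i
      exact Fin.ext (congrFun (h1.trans h2.symm) i)
    · intro t ht
      rw [mem_powersetCard] at ht
      have hmem (i : Fin a) := mem_Icc.1 (ht.1 (orderEmbOfFin_mem t ht.2 i))
      refine ⟨fun i ↦ ⟨t.orderEmbOfFin ht.2 i, by have := hmem i; omega⟩, ?_, ?_⟩
      · simp only [mem_filter, mem_univ, true_and, Fin.mk_lt_mk]
        exact ⟨fun i ↦ (hmem i).1, fun i j h ↦ (t.orderEmbOfFin ht.2).strictMono h⟩
      · exact image_orderEmbOfFin_univ t ht.2
    · intro k hk
      simp only [mem_filter, mem_univ, true_and] at hk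
      rw [prod_image (hinj hk.2).injOn]
  rw [hsum, map_sum, MO, sum_filter, sum_filter,
    ← (Equiv.arrowProdEquivProdArrow (Fin a) (fun _ ↦ Fin (n + 1))
      (fun _ ↦ Fin (n + 1))).symm.sum_comp, Fintype.sum_prod_type]
  push_cast
  refine sum_congr rfl fun k _ ↦ ?_
  split_ifs with hk
  · simp only [truncLambert, sum_range, prod_univ_sum, Fintype.piFinset_univ, map_sum]
    refine sum_congr rfl fun s _ ↦ ?_
    rw [prod_mul_distrib, prod_pow_eq_pow_sum, ← Nat.cast_prod, ← map_natCast (C (R := R)),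
      coeff_C_mul_X_pow]
    simp only [Equiv.arrowProdEquivProdArrow_symm_apply]
    by_cases hs : ∀ i, 0 < (s i : ℕ)
    · simp only [hk.1, hs, and_self, implies_true, true_and, and_iff_right hk.2, eq_comm (a := n),
        Nat.cast_prod]
    · obtain ⟨i, hi⟩ := not_forall.1 hs
      have h0 : ∏ i, (s i : ℕ) = 0 := prod_eq_zero (mem_univ i) (by omega)
      rw [h0, Nat.cast_zero, ite_self, if_neg fun h ↦ hs fun i ↦ (h.1 i).2]
  · refine (sum_eq_zero fun s _ ↦ if_neg ?_).symm
    exact fun h ↦ hk ⟨fun i ↦ (h.1 i).1, h.2.1⟩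

end MacMahon

/-- Modulo `11`, the vanishing of six parts of the cube of `∑ i, a i`, graded by residues modulo
`11` with `a 3 = a 6 = a 8 = a 9 = a 10 = 0`, forces the part of degree `7` of its eighth power to
vanish. Here `b` and `d` are the parts of the second and fourth powers. -/
theorem octic_eq_zero_of_cubics_eq_zero {R : Type*} [CommRing R] (h11 : (11 : R) = 0)
    {a0 a1 a2 a4 a5 a7 b0 b1 b2 b3 b4 b5 b6 b7 b8 b9 b10 d0 d1 d2 d3 d4 d5 d6 d7 d8 d9 d10 : R}
    (hb0 : b0 = a0 * a0 + a4 * a7 + a7 * a4)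
    (hb1 : b1 = a0 * a1 + a1 * a0 + a5 * a7 + a7 * a5)
    (hb2 : b2 = a0 * a2 + a1 * a1 + a2 * a0)
    (hb3 : b3 = a1 * a2 + a2 * a1 + a7 * a7)
    (hb4 : b4 = a0 * a4 + a2 * a2 + a4 * a0)
    (hb5 : b5 = a0 * a5 + a1 * a4 + a4 * a1 + a5 * a0)
    (hb6 : b6 = a1 * a5 + a2 * a4 + a4 * a2 + a5 * a1)
    (hb7 : b7 = a0 * a7 + a2 * a5 + a5 * a2 + a7 * a0)
    (hb8 : b8 = a1 * a7 + a4 * a4 + a7 * a1)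
    (hb9 : b9 = a2 * a7 + a4 * a5 + a5 * a4 + a7 * a2)
    (hb10 : b10 = a5 * a5)
    (hd0 : d0 = b0 * b0 + b1 * b10 + b2 * b9 + b3 * b8 + b4 * b7 + b5 * b6 + b6 * b5 + b7 * b4 +
      b8 * b3 + b9 * b2 + b10 * b1)
    (hd1 : d1 = b0 * b1 + b1 * b0 + b2 * b10 + b3 * b9 + b4 * b8 + b5 * b7 + b6 * b6 + b7 * b5 +
      b8 * b4 + b9 * b3 + b10 * b2)
    (hd2 : d2 = b0 * b2 + b1 * b1 + b2 * b0 + b3 * b10 + b4 * b9 + b5 * b8 + b6 * b7 + b7 * b6 +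
      b8 * b5 + b9 * b4 + b10 * b3)
    (hd3 : d3 = b0 * b3 + b1 * b2 + b2 * b1 + b3 * b0 + b4 * b10 + b5 * b9 + b6 * b8 + b7 * b7 +
      b8 * b6 + b9 * b5 + b10 * b4)
    (hd4 : d4 = b0 * b4 + b1 * b3 + b2 * b2 + b3 * b1 + b4 * b0 + b5 * b10 + b6 * b9 + b7 * b8 +
      b8 * b7 + b9 * b6 + b10 * b5)
    (hd5 : d5 = b0 * b5 + b1 * b4 + b2 * b3 + b3 * b2 + b4 * b1 + b5 * b0 + b6 * b10 + b7 * b9 +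
      b8 * b8 + b9 * b7 + b10 * b6)
    (hd6 : d6 = b0 * b6 + b1 * b5 + b2 * b4 + b3 * b3 + b4 * b2 + b5 * b1 + b6 * b0 + b7 * b10 +
      b8 * b9 + b9 * b8 + b10 * b7)
    (hd7 : d7 = b0 * b7 + b1 * b6 + b2 * b5 + b3 * b4 + b4 * b3 + b5 * b2 + b6 * b1 + b7 * b0 +
      b8 * b10 + b9 * b9 + b10 * b8)
    (hd8 : d8 = b0 * b8 + b1 * b7 + b2 * b6 + b3 * b5 + b4 * b4 + b5 * b3 + b6 * b2 + b7 * b1 +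
      b8 * b0 + b9 * b10 + b10 * b9)
    (hd9 : d9 = b0 * b9 + b1 * b8 + b2 * b7 + b3 * b6 + b4 * b5 + b5 * b4 + b6 * b3 + b7 * b2 +
      b8 * b1 + b9 * b0 + b10 * b10)
    (hd10 : d10 = b0 * b10 + b1 * b9 + b2 * b8 + b3 * b7 + b4 * b6 + b5 * b5 + b6 * b4 + b7 * b3
      + b8 * b2 + b9 * b1 + b10 * b0)
    (h2 : b0 * a2 + b1 * a1 + b2 * a0 + b6 * a7 + b8 * a5 + b9 * a4 = 0)
    (h4 : b0 * a4 + b2 * a2 + b3 * a1 + b4 * a0 + b8 * a7 + b10 * a5 = 0)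
    (h5 : b0 * a5 + b1 * a4 + b3 * a2 + b4 * a1 + b5 * a0 + b9 * a7 = 0)
    (h7 : b0 * a7 + b2 * a5 + b3 * a4 + b5 * a2 + b6 * a1 + b7 * a0 = 0)
    (h8 : b1 * a7 + b3 * a5 + b4 * a4 + b6 * a2 + b7 * a1 + b8 * a0 = 0)
    (h9 : b2 * a7 + b4 * a5 + b5 * a4 + b7 * a2 + b8 * a1 + b9 * a0 = 0)
    : d0 * d7 + d1 * d6 + d2 * d5 + d3 * d4 + d4 * d3 + d5 * d2 + d6 * d1 + d7 * d0 +
      d8 * d10 + d9 * d9 + d10 * d8 = 0 := by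
  subst hd0 hd1 hd2 hd3 hd4 hd5 hd6 hd7 hd8 hd9 hd10 hb0 hb1 hb2 hb3 hb4 hb5 hb6 hb7 hb8 hb9 hb10
  linear_combination
    (-5 * a1 ^ 2 * a4 * a5 ^ 2 + 4 * a1 * a2 * a4 ^ 2 * a5 - 2 * a1 * a5 * a7 ^ 3 - 4 * a2 ^ 3 *
      a5 ^ 2 + 2 * a4 ^ 2 * a5 * a7 ^ 2 - 3 * a0 * a1 * a5 ^ 3 - 4 * a2 ^ 2 * a4 ^ 3 - 2 * a0 ^
      2 * a1 * a2 ^ 2 - a1 ^ 5 - 5 * a0 ^ 4 * a5 + 4 * a0 ^ 3 * a1 * a4 + 3 * a1 ^ 2 * a2 * a5 *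
      a7 - a0 * a2 ^ 2 * a5 * a7) * h2 +
    (2 * a0 ^ 2 * a1 ^ 3 + 3 * a1 * a2 ^ 2 * a4 * a5 + 4 * a2 * a4 * a5 * a7 ^ 2 + 2 * a2 ^ 2 *
      a7 ^ 3 + a5 ^ 5 + 2 * a1 ^ 2 * a4 ^ 3 + 3 * a0 * a4 * a7 ^ 3 - 2 * a0 * a2 * a4 ^ 3 + 4 *
      a0 ^ 2 * a2 * a5 * a7 + 5 * a0 ^ 3 * a7 ^ 2) * h4 +
    (a0 * a1 ^ 2 * a4 * a7 - a0 * a1 * a4 ^ 3 - 4 * a0 ^ 3 * a1 ^ 2 - 4 * a1 ^ 2 * a2 ^ 2 * a7 -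
      3 * a0 * a5 ^ 2 * a7 ^ 2 - a7 ^ 5 + 4 * a2 ^ 4 * a5) * h5 +
    (5 * a1 ^ 3 * a4 ^ 2 + 3 * a1 * a2 ^ 3 * a4 + 3 * a0 ^ 2 * a2 ^ 2 * a7 - a0 ^ 2 * a2 * a4 *
      a5 - 2 * a1 * a4 * a5 ^ 2 * a7 - 3 * a0 ^ 3 * a4 * a7 + 5 * a0 * a1 ^ 2 * a4 * a5 + 2 * a0
      * a1 * a2 * a4 ^ 2 + 2 * a0 ^ 2 * a1 * a5 ^ 2 - 2 * a1 ^ 4 * a7 - 2 * a0 * a1 ^ 2 * a2 *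
      a7 - a0 ^ 5) * h7 +
    (4 * a0 * a1 ^ 3 * a7 - 2 * a1 * a2 * a4 * a7 ^ 2 + 2 * a0 ^ 2 * a7 ^ 3 + a0 ^ 3 * a5 ^ 2 -
      a0 * a4 * a5 ^ 2 * a7 - a2 ^ 5 - a0 * a2 * a5 * a7 ^ 2 - 5 * a4 ^ 4 * a5 - 4 * a0 * a1 *
      a2 ^ 2 * a5 + 2 * a0 * a2 ^ 3 * a4 - 5 * a4 * a7 ^ 4 - 5 * a2 * a4 ^ 3 * a7 + 2 * a1 ^ 2 *
      a5 * a7 ^ 2) * h8 +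
    (4 * a1 * a4 * a5 ^ 3 - a5 ^ 2 * a7 ^ 3 + 5 * a2 ^ 2 * a4 * a5 * a7 - 3 * a0 ^ 2 * a2 ^ 2 *
      a5 - 3 * a1 ^ 4 * a5 - 5 * a0 ^ 3 * a4 * a5 - a4 ^ 5 + 2 * a1 * a2 ^ 4 - 3 * a1 ^ 3 * a2 *
      a4 - 2 * a2 ^ 3 * a7 ^ 2 - 3 * a0 ^ 2 * a1 * a4 ^ 2 - 3 * a0 * a1 * a5 * a7 ^ 2) * h9 +
    (7 * a4 * a5 * a7 ^ 6 + 15 * a4 ^ 2 * a5 ^ 5 * a7 + 39 * a4 ^ 4 * a5 ^ 2 * a7 ^ 2 + a2 * a7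
      ^ 7 + 76 * a2 * a4 * a5 ^ 4 * a7 ^ 2 + 101 * a2 * a4 ^ 3 * a5 * a7 ^ 3 + 51 * a2 ^ 2 * a5
      ^ 3 * a7 ^ 3 + 39 * a2 ^ 2 * a4 ^ 2 * a7 ^ 4 + 18 * a2 ^ 2 * a4 ^ 5 * a5 + 52 * a2 ^ 3 *
      a4 ^ 2 * a5 ^ 3 + 29 * a2 ^ 3 * a4 ^ 4 * a7 + 75 * a2 ^ 4 * a4 * a5 ^ 2 * a7 + 15 * a2 ^ 5
      * a5 * a7 ^ 2 + a2 ^ 7 * a4 + 15 * a1 * a5 ^ 5 * a7 ^ 2 + 153 * a1 * a4 ^ 2 * a5 ^ 2 * a7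
      ^ 3 + a1 * a4 ^ 7 + 156 * a1 * a2 * a4 * a5 * a7 ^ 4 + 78 * a1 * a2 * a4 ^ 4 * a5 ^ 2 + 15
      * a1 * a2 ^ 2 * a7 ^ 5) * h11 +
    (75 * a1 * a2 ^ 2 * a4 * a5 ^ 4 + 306 * a1 * a2 ^ 2 * a4 ^ 3 * a5 * a7 + 104 * a1 * a2 ^ 3 *
      a5 ^ 3 * a7 + 153 * a1 * a2 ^ 3 * a4 ^ 2 * a7 ^ 2 + 4 * a1 * a2 ^ 6 * a5 + 39 * a1 ^ 2 *
      a5 ^ 2 * a7 ^ 4 + 51 * a1 ^ 2 * a4 ^ 3 * a5 ^ 3 + 15 * a1 ^ 2 * a4 ^ 5 * a7 + 15 * a1 ^ 2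
      * a2 * a5 ^ 5 + 459 * a1 ^ 2 * a2 * a4 ^ 2 * a5 ^ 2 * a7 + 456 * a1 ^ 2 * a2 ^ 2 * a4 * a5
      * a7 ^ 2 + 52 * a1 ^ 2 * a2 ^ 3 * a7 ^ 3 + 36 * a1 ^ 2 * a2 ^ 4 * a4 ^ 2 + 104 * a1 ^ 3 *
      a4 * a5 ^ 3 * a7 + 49 * a1 ^ 3 * a4 ^ 3 * a7 ^ 2 + 150 * a1 ^ 3 * a2 * a5 ^ 2 * a7 ^ 2 +
      101 * a1 ^ 3 * a2 ^ 3 * a4 * a5 + 26 * a1 ^ 3 * a2 ^ 4 * a7 + 26 * a1 ^ 4 * a4 * a7 ^ 3 +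
      23 * a1 ^ 4 * a2 * a4 ^ 3) * h11 +
    (39 * a1 ^ 4 * a2 ^ 2 * a5 ^ 2 + 15 * a1 ^ 5 * a4 ^ 2 * a5 + 33 * a1 ^ 5 * a2 * a4 * a7 + 7
      * a1 ^ 6 * a5 * a7 + 104 * a0 * a4 * a5 ^ 3 * a7 ^ 3 + 26 * a0 * a4 ^ 3 * a7 ^ 4 + 7 * a0
      * a4 ^ 6 * a5 + 78 * a0 * a2 * a5 ^ 2 * a7 ^ 4 + 102 * a0 * a2 * a4 ^ 3 * a5 ^ 3 + 33 * a0
      * a2 * a4 ^ 5 * a7 + 15 * a0 * a2 ^ 2 * a5 ^ 5 + 456 * a0 * a2 ^ 2 * a4 ^ 2 * a5 ^ 2 * a7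
      + 303 * a0 * a2 ^ 3 * a4 * a5 * a7 ^ 2 + 26 * a0 * a2 ^ 4 * a7 ^ 3 + 15 * a0 * a2 ^ 5 * a4
      ^ 2 + 33 * a0 * a1 * a4 * a7 ^ 5 + 75 * a0 * a1 * a4 ^ 2 * a5 ^ 4 + 156 * a0 * a1 * a4 ^ 4
      * a5 * a7 + 612 * a0 * a1 * a2 * a4 * a5 ^ 3 * a7 + 309 * a0 * a1 * a2 * a4 ^ 3 * a7 ^ 2)
      * h11 +
    (462 * a0 * a1 * a2 ^ 2 * a5 ^ 2 * a7 ^ 2 + 147 * a0 * a1 * a2 ^ 4 * a4 * a5 + 30 * a0 * a1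
      * a2 ^ 5 * a7 + 78 * a0 * a1 ^ 2 * a5 ^ 4 * a7 + 456 * a0 * a1 ^ 2 * a4 ^ 2 * a5 * a7 ^ 2
      + 306 * a0 * a1 ^ 2 * a2 * a4 * a7 ^ 3 + 153 * a0 * a1 ^ 2 * a2 ^ 2 * a4 ^ 3 + 156 * a0 *
      a1 ^ 2 * a2 ^ 3 * a5 ^ 2 + 101 * a0 * a1 ^ 3 * a5 * a7 ^ 3 + 300 * a0 * a1 ^ 3 * a2 * a4 ^
      2 * a5 + 309 * a0 * a1 ^ 3 * a2 ^ 2 * a4 * a7 + 78 * a0 * a1 ^ 4 * a4 * a5 ^ 2 + 153 * a0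
      * a1 ^ 4 * a2 * a5 * a7 + a0 * a1 ^ 7 + 15 * a0 ^ 2 * a5 * a7 ^ 5 + 15 * a0 ^ 2 * a4 * a5
      ^ 5 + 153 * a0 ^ 2 * a4 ^ 3 * a5 ^ 2 * a7 + 76 * a0 ^ 2 * a2 * a5 ^ 4 * a7 + 456 * a0 ^ 2
      * a2 * a4 ^ 2 * a5 * a7 ^ 2 + 150 * a0 ^ 2 * a2 ^ 2 * a4 * a7 ^ 3) * h11 +
    (52 * a0 ^ 2 * a2 ^ 3 * a4 ^ 3 + 39 * a0 ^ 2 * a2 ^ 4 * a5 ^ 2 + 462 * a0 ^ 2 * a1 * a4 * a5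
      ^ 2 * a7 ^ 2 + 306 * a0 ^ 2 * a1 * a2 * a5 * a7 ^ 3 + 459 * a0 ^ 2 * a1 * a2 ^ 2 * a4 ^ 2
      * a5 + 303 * a0 ^ 2 * a1 * a2 ^ 3 * a4 * a7 + 39 * a0 ^ 2 * a1 ^ 2 * a4 ^ 4 + 456 * a0 ^ 2
      * a1 ^ 2 * a2 * a4 * a5 ^ 2 + 462 * a0 ^ 2 * a1 ^ 2 * a2 ^ 2 * a5 * a7 + 51 * a0 ^ 2 * a1
      ^ 3 * a5 ^ 3 + 150 * a0 ^ 2 * a1 ^ 3 * a4 ^ 2 * a7 + 36 * a0 ^ 2 * a1 ^ 4 * a7 ^ 2 + 15 *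
      a0 ^ 2 * a1 ^ 5 * a2 + 51 * a0 ^ 3 * a5 ^ 3 * a7 ^ 2 + 49 * a0 ^ 3 * a4 ^ 2 * a7 ^ 3 + 26
      * a0 ^ 3 * a2 * a4 ^ 4 + 156 * a0 ^ 3 * a2 ^ 2 * a4 * a5 ^ 2 + 101 * a0 ^ 3 * a2 ^ 3 * a5
      * a7 + 23 * a0 ^ 3 * a1 * a7 ^ 4 + 104 * a0 ^ 3 * a1 * a4 ^ 3 * a5) * h11 +
    (101 * a0 ^ 3 * a1 * a2 * a5 ^ 3 + 306 * a0 ^ 3 * a1 * a2 * a4 ^ 2 * a7 + 306 * a0 ^ 3 * a1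
      ^ 2 * a4 * a5 * a7 + 153 * a0 ^ 3 * a1 ^ 2 * a2 * a7 ^ 2 + 52 * a0 ^ 3 * a1 ^ 3 * a2 ^ 2 +
      42 * a0 ^ 4 * a4 ^ 2 * a5 ^ 2 + 159 * a0 ^ 4 * a2 * a4 * a5 * a7 + 36 * a0 ^ 4 * a2 ^ 2 *
      a7 ^ 2 + 78 * a0 ^ 4 * a1 * a5 ^ 2 * a7 + 26 * a0 ^ 4 * a1 * a2 ^ 3 + 26 * a0 ^ 4 * a1 ^ 3
      * a4 + 15 * a0 ^ 5 * a4 * a7 ^ 2 + 30 * a0 ^ 5 * a1 * a2 * a4 + 18 * a0 ^ 5 * a1 ^ 2 * a5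
      + 7 * a0 ^ 6 * a2 * a5 + a0 ^ 7 * a7) * h11
section ResiduePart

open PowerSeries

/-- The part of a power series supported on the exponents congruent to `r` modulo `p`. -/
noncomputable def residuePart {R : Type*} [CommRing R] {p : ℕ} (r : ZMod p) (f : R⟦X⟧) : R⟦X⟧ :=
  mk fun n ↦ if (n : ZMod p) = r then coeff n f else 0

variable {R : Type*} [CommRing R] {p : ℕ}

theorem coeff_residuePart (r : ZMod p) (f : R⟦X⟧) (n : ℕ) :
    coeff n (residuePart r f) = if (n : ZMod p) = r then coeff n f else 0 :=
  coeff_mk _ _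

theorem residuePart_mul [NeZero p] (r : ZMod p) (f g : R⟦X⟧) :
    residuePart r (f * g) = ∑ i : ZMod p, residuePart i f * residuePart (r - i) g := by
  ext n
  simp only [coeff_residuePart, map_sum, coeff_mul]
  rw [sum_comm]
  by_cases hn : (n : ZMod p) = r
  · rw [if_pos hn]
    refine sum_congr rfl fun x hx ↦ ?_
    rw [HasAntidiagonal.mem_antidiagonal] at hx
    rw [sum_eq_single (x.1 : ZMod p), if_pos rfl, if_pos]
    · rw [← hn, ← hx]; push_cast; ring
    · intro i _ hi; rw [if_neg hi.symm, zero_mul]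
    · simp
  · rw [if_neg hn]
    refine (sum_eq_zero fun x hx ↦ sum_eq_zero fun i _ ↦ ?_).symm
    rw [HasAntidiagonal.mem_antidiagonal] at hx
    refine (ite_zero_mul_ite_zero ..).trans (if_neg ?_)
    rintro ⟨h1, h2⟩
    apply hn
    rw [← hx, Nat.cast_add, h1, h2]
    ring

theorem residuePart_sub (r : ZMod p) (f g : R⟦X⟧) :
    residuePart r (f - g) = residuePart r f - residuePart r g := by
  ext n
  simp only [coeff_residuePart, map_sub]
  split_ifs <;> simp

theorem X_pow_dvd_residuePart (r : ZMod p) {f : R⟦X⟧} {m : ℕ} (h : X ^ m ∣ f) :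
    X ^ m ∣ residuePart r f := by
  rw [X_pow_dvd_iff] at h ⊢
  intro n hn
  rw [coeff_residuePart, h n hn, ite_self]

theorem residuePart_eq_zero {r : ZMod p} {f : R⟦X⟧}
    (h : ∀ n : ℕ, (n : ZMod p) = r → coeff n f = 0) : residuePart r f = 0 := by
  ext n
  rw [coeff_residuePart, map_zero, ite_eq_right_iff]
  exact h n

theorem residuePart_mul_of_supported [NeZero p] (r : ZMod p) (f : R⟦X⟧) {g : R⟦X⟧}
    (hg : ∀ i : ZMod p, i ≠ 0 → residuePart i g = 0) :
    residuePart r (f * g) = residuePart r f * g := by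
  have hg0 : residuePart (0 : ZMod p) g = g := by
    ext n
    rw [coeff_residuePart, ite_eq_left_iff]
    intro hn
    have := congrArg (coeff n) (hg n hn)
    rw [coeff_residuePart, if_pos rfl, map_zero] at this
    exact this.symm
  rw [residuePart_mul, sum_eq_single r, sub_self, hg0]
  · exact fun i _ hi ↦ by rw [hg _ (sub_ne_zero.2 hi.symm), mul_zero]
  · simp

theorem residuePart_pow_char [Fact p.Prime] (f : (ZMod p)⟦X⟧) {i : ZMod p} (hi : i ≠ 0) :
    residuePart i (f ^ p) = 0 := by
  refine residuePart_eq_zero fun n hn ↦ ?_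
  obtain _ | n := n
  · simp_all
  have h : coeff n (d⁄dX (ZMod p) (f ^ p)) = 0 := by
    rw [Derivation.leibniz_pow]
    rw [nsmul_eq_mul, ← map_natCast (C (R := ZMod p)), ZMod.natCast_self, map_zero, zero_mul,
      map_zero]
  rw [coeff_derivative] at h
  exact (mul_eq_zero.1 h).resolve_right (by exact_mod_cast hn ▸ hi)

theorem sum_zmod_eleven {M : Type*} [AddCommMonoid M] (F : ZMod 11 → M) :
    ∑ i, F i = F 0 + F 1 + F 2 + F 3 + F 4 + F 5 + F 6 + F 7 + F 8 + F 9 + F 10 := by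
  have h (F : Fin 11 → M) :
      ∑ i, F i = F 0 + F 1 + F 2 + F 3 + F 4 + F 5 + F 6 + F 7 + F 8 + F 9 + F 10 := by
    simp only [Fin.sum_univ_castSucc, Fin.sum_univ_zero, zero_add]
    rfl
  exact h F

theorem residuePart_seven_pow_eight (f : (ZMod 11)⟦X⟧)
    (h : ∀ i : ZMod 11, i ∈ ({3, 6, 8, 9, 10} : Finset (ZMod 11)) → residuePart i f = 0)
    (h' : ∀ i : ZMod 11, i ∈ ({2, 4, 5, 7, 8, 9} : Finset (ZMod 11)) → residuePart i (f ^ 3) = 0) :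
    residuePart (7 : ZMod 11) (f ^ 8) = 0 := by
  have h11 : (11 : (ZMod 11)⟦X⟧) = 0 := by
    rw [← map_ofNat (C (R := ZMod 11)), show (OfNat.ofNat 11 : ZMod 11) = 0 from rfl, map_zero]
  have key : ∀ i : ZMod 11, i ∈ ({2, 4, 5, 7, 8, 9} : Finset (ZMod 11)) →
      residuePart i (f * f * f) = 0 := by simpa only [pow_succ, pow_zero, one_mul] using h'
  rw [show f ^ 8 = (f * f * (f * f)) * (f * f * (f * f)) by ring]
  have h3 := h 3 (by decide)
  have h6 := h 6 (by decide)
  have h8 := h 8 (by decide)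
  have h9 := h 9 (by decide)
  have h10 := h 10 (by decide)
  have k2 := key 2 (by decide)
  have k4 := key 4 (by decide)
  have k5 := key 5 (by decide)
  have k7 := key 7 (by decide)
  have k8 := key 8 (by decide)
  have k9 := key 9 (by decide)
  rw [residuePart_mul, sum_zmod_eleven] at k2 k4 k5 k7 k8 k9 ⊢
  reduce_mod_char at k2 k4 k5 k7 k8 k9 ⊢
  simp only [h3, h6, h8, h9, h10, mul_zero, add_zero, zero_add] at k2 k4 k5 k7 k8 k9
  refine octic_eq_zero_of_cubics_eq_zero h11 ?_ ?_ ?_ ?_ ?_ ?_ ?_ ?_ ?_ ?_ ?_ ?_ ?_ ?_ ?_ ?_ ?_ ?_ ?_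
    ?_ ?_ ?_ k2 k4 k5 k7 k8 k9
  all_goals
    rw [residuePart_mul, sum_zmod_eleven]
    reduce_mod_char
  all_goals simp only [h3, h6, h8, h9, h10, mul_zero, zero_mul, add_zero, zero_add]

end ResiduePart

section Theta

open PowerSeries

/-- The coefficient of `X ^ tri n` in the theta series attached to the MacMahon series of
index `a`, up to sign. -/
def thetaCoeff (n a : ℕ) : ℕ := (n + a).choose (2 * a) + 2 * (n + a).choose (2 * a + 1)

/-- The theta series attached to the MacMahon series of index `a`, truncated after `N + 1` terms. -/
noncomputable def truncTheta (R : Type*) [CommRing R] (N a : ℕ) : R⟦X⟧ :=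
  ∑ n ∈ range (N + 1), C ((-1) ^ n * ((-1) ^ a * (thetaCoeff n a : R))) * X ^ tri n

theorem residuePart_truncTheta {R : Type*} [CommRing R] {p : ℕ} (r : ZMod p) (N a : ℕ)
    (h : ∀ n : ℕ, (thetaCoeff n a : R) = 0 ∨ (tri n : ZMod p) ≠ r) :
    residuePart r (truncTheta R N a) = 0 := by
  refine residuePart_eq_zero fun k hk ↦ ?_
  rw [truncTheta, map_sum]
  refine sum_eq_zero fun n _ ↦ ?_
  rw [coeff_C_mul_X_pow, ite_eq_right_iff]
  rintro rfl
  rw [(h n).resolve_right (not_not.2 hk), mul_zero, mul_zero]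

theorem X_pow_dvd_qPoch_pow_three_mul_truncMacMahon_sub {R : Type*} [CommRing R] [IsDomain R]
    (N a : ℕ) :
    (X : R⟦X⟧) ^ (N + 1) ∣ qPoch X N ^ 3 * truncMacMahon R N a - truncTheta R N a := by
  have hq (n : ℕ) : qPoch (X : R⟦X⟧) n ≠ 0 := by
    intro h
    simpa [qPoch, map_prod] using congrArg constantCoeff h
  have hsum : (X : R⟦X⟧) ^ (N + 1) ∣ qPoch X N *
      (∏ k ∈ range N, (Polynomial.C ((1 - (X : R⟦X⟧) ^ (k + 1)) ^ 2) +
        Polynomial.C (X ^ (k + 1)) * Polynomial.X)).coeff a - truncTheta R N a := by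
    rw [prod_eq_sum_tripleCoeff, Polynomial.finsetSum_coeff, truncTheta, mul_sum,
      ← sum_sub_distrib]
    refine dvd_sum fun n hn ↦ ?_
    obtain ⟨c, hc⟩ := pow_dvd_qPoch_mul_tripleCoeff_sub (X : R⟦X⟧) hq
      (Nat.lt_succ_iff.1 (mem_range.1 hn))
    rw [← Polynomial.C_1, ← Polynomial.C_neg, ← Polynomial.C_pow, ← Polynomial.C_mul,
      Polynomial.coeff_C_mul, coeff_chebyshevW]
    refine ⟨(-1) ^ n * ((-1) ^ a * (thetaCoeff n a : R⟦X⟧)) * c, ?_⟩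
    simp only [map_mul, map_pow, map_neg, map_one, map_natCast]
    rw [← thetaCoeff]
    linear_combination (-1) ^ n * ((-1) ^ a * (thetaCoeff n a : R⟦X⟧)) * hc
  convert ((X_pow_dvd_qPoch_sq_mul_truncMacMahon_sub (R := R) N a).mul_left (qPoch X N)).add hsum
    using 1
  ring

theorem X_pow_dvd_qPoch_sub_pentagonalSeries (R : Type*) [CommRing R] (N : ℕ) :
    (X : R⟦X⟧) ^ (N + 1) ∣ qPoch X N - pentagonalSeries R := by
  rw [X_pow_dvd_iff]
  intro n hn
  obtain ⟨M, hM⟩ := Filter.eventually_atTop.1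
    (Filter.tendsto_finset_range.eventually (coeff_prod_one_sub_X_pow_eventually_eq R n))
  have h := X_pow_dvd_iff.1 (pow_dvd_qPoch_add_sub (X : R⟦X⟧) N M) n hn
  rw [map_sub, sub_eq_zero] at h ⊢
  rw [← h, ← hM (N + M) (Nat.le_add_left _ _), qPoch]

theorem X_pow_dvd_pentagonalSeries_pow_three_mul_truncMacMahon_sub (R : Type*) [CommRing R]
    [IsDomain R] (N a : ℕ) :
    (X : R⟦X⟧) ^ (N + 1) ∣
      pentagonalSeries R ^ 3 * truncMacMahon R N a - truncTheta R N a := by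
  have h := (X_pow_dvd_qPoch_sub_pentagonalSeries R N).trans
    (sub_dvd_pow_sub_pow (qPoch X N) (pentagonalSeries R) 3)
  convert (X_pow_dvd_qPoch_pow_three_mul_truncMacMahon_sub (R := R) N a).sub
    (h.mul_right (truncMacMahon R N a)) using 1
  ring

theorem truncMacMahon_zero (R : Type*) [CommRing R] (N : ℕ) : truncMacMahon R N 0 = 1 := by
  simp [truncMacMahon]

instance fact_prime_eleven : Fact (Nat.Prime 11) := ⟨by norm_num⟩

theorem natCast_tri (n : ℕ) : (tri n : ZMod 11) = 6 * (n * (n + 1)) := by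
  have h : tri n * 2 = n * (n + 1) := Nat.div_mul_cancel (Nat.even_mul_succ_self n).two_dvd
  have h2 : (tri n : ZMod 11) * 2 = n * (n + 1) := by
    exact_mod_cast congrArg (Nat.cast : ℕ → ZMod 11) h
  rw [← h2, mul_left_comm, show (6 : ZMod 11) * 2 = 1 from rfl, mul_one]

theorem residuePart_pentagonalSeries {i : ZMod 11}
    (hi : i ∈ ({3, 6, 8, 9, 10} : Finset (ZMod 11))) :
    residuePart i (pentagonalSeries (ZMod 11)) = 0 := by
  refine residuePart_eq_zero fun n hn ↦ coeff_pentagonalSeries_eq_zero _ ?_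
  rintro ⟨k, rfl⟩
  have h : (2 : ZMod 11) * (pentagonal k : ℕ) = k * (3 * k - 1) := by
    exact_mod_cast congrArg (Int.cast : ℤ → ZMod 11) (two_mul_natCast_pentagonal k)
  rw [hn] at h
  clear hn
  generalize (k : ZMod 11) = x at h
  revert i x
  decide

theorem residuePart_pentagonalSeries_pow_three {i : ZMod 11}
    (hi : i ∈ ({2, 4, 5, 7, 8, 9} : Finset (ZMod 11))) :
    residuePart i (pentagonalSeries (ZMod 11) ^ 3) = 0 := by
  refine residuePart_eq_zero fun n hn ↦ ?_
  have hθ : residuePart i (truncTheta (ZMod 11) n 0) = 0 := by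
    refine residuePart_truncTheta i n 0 fun k ↦ ?_
    rw [natCast_tri]
    simp only [thetaCoeff, mul_zero, zero_add, add_zero, Nat.choose_zero_right,
      Nat.choose_one_right]
    push_cast
    generalize (k : ZMod 11) = x
    clear hn
    revert i x
    decide
  have h := X_pow_dvd_iff.1 (X_pow_dvd_pentagonalSeries_pow_three_mul_truncMacMahon_sub
    (ZMod 11) n 0) n n.lt_succ_self
  rw [truncMacMahon_zero, mul_one, map_sub, sub_eq_zero] at h
  rw [h]
  simpa only [coeff_residuePart, if_pos hn, map_zero] using congrArg (coeff n) hθ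

theorem thetaCoeff_eq_zero {n : ℕ} (m : ℕ) (h0 : n % 11 ≠ 0) (h10 : n % 11 ≠ 10) :
    (thetaCoeff n (11 * m + 10) : ZMod 11) = 0 := by
  have key (c : ℕ) (hc : 8 < c % 11) :
      (((n + (11 * m + 10)).choose c : ℕ) : ZMod 11) = 0 := by
    have h := (ZMod.natCast_eq_natCast_iff _ _ _).2
      (Choose.choose_modEq_choose_mod_mul_choose_div_nat (p := 11)
        (n := n + (11 * m + 10)) (k := c))
    rw [h, Nat.choose_eq_zero_of_lt (by omega), zero_mul, Nat.cast_zero]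
  rw [thetaCoeff, Nat.cast_add, Nat.cast_mul, key _ (by omega), key _ (by omega), mul_zero,
    add_zero]

theorem residuePart_truncTheta_eleven {i : ZMod 11} (hi : i ≠ 0) (N m : ℕ) :
    residuePart i (truncTheta (ZMod 11) N (11 * m + 10)) = 0 := by
  refine residuePart_truncTheta i N _ fun n ↦ ?_
  by_cases h0 : n % 11 = 0
  · refine .inr ?_
    have : (n : ZMod 11) = 0 := (ZMod.natCast_eq_zero_iff _ _).2 (Nat.dvd_of_mod_eq_zero h0)
    rw [natCast_tri, this, zero_mul, mul_zero]
    exact hi.symm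
  by_cases h10 : n % 11 = 10
  · refine .inr ?_
    have : ((n + 1 : ℕ) : ZMod 11) = 0 :=
      (ZMod.natCast_eq_zero_iff _ _).2 (Nat.dvd_of_mod_eq_zero (by omega))
    rw [natCast_tri, ← Nat.cast_succ, this, mul_zero, mul_zero]
    exact hi.symm
  exact .inl (thetaCoeff_eq_zero m h0 h10)

end Theta

/-- for all non-negative integers `n` and `m`,
`MO (11m+10; 11n+7) ≡ 0 (mod 11)`; the case `m = 0` is the conjecture of
Amdeberhan-Andrews-Tauraso. -/
theorem MO_mod_eleven (n m : ℕ) :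
    11 ∣ MO (11 * m + 10) (11 * n + 7) := by
  rw [← ZMod.natCast_eq_zero_iff, ← coeff_truncMacMahon]
  set N := 11 * n + 7 with hN
  set U := truncMacMahon (ZMod 11) N (11 * m + 10)
  set φ := PowerSeries.pentagonalSeries (ZMod 11)
  set θ := truncTheta (ZMod 11) N (11 * m + 10)
  have hdvd : (PowerSeries.X : PowerSeries (ZMod 11)) ^ (N + 1) ∣ U * φ ^ 11 - φ ^ 8 * θ := by
    convert (X_pow_dvd_pentagonalSeries_pow_three_mul_truncMacMahon_sub (ZMod 11) N
      (11 * m + 10)).mul_left (φ ^ 8) using 1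
    ring
  have hU : (PowerSeries.X : PowerSeries (ZMod 11)) ^ (N + 1) ∣
      residuePart (7 : ZMod 11) U * φ ^ 11 := by
    have h := X_pow_dvd_residuePart (7 : ZMod 11) hdvd
    rwa [residuePart_sub, residuePart_mul_of_supported _ _ fun i hi ↦ residuePart_pow_char φ hi,
      residuePart_mul_of_supported _ _ fun i hi ↦ residuePart_truncTheta_eleven hi N m,
      residuePart_seven_pow_eight φ (fun i ↦ residuePart_pentagonalSeries)
        (fun i ↦ residuePart_pentagonalSeries_pow_three), zero_mul, sub_zero] at h
  have hφ : IsCoprime (PowerSeries.X : PowerSeries (ZMod 11)) φ := by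
    obtain ⟨c, hc⟩ := X_pow_dvd_qPoch_sub_pentagonalSeries (ZMod 11) 0
    rw [qPoch_zero, zero_add, pow_one] at hc
    exact ⟨c, 1, by linear_combination -hc⟩
  have h := PowerSeries.X_pow_dvd_iff.1 (hφ.pow.dvd_of_dvd_mul_right hU) N N.lt_succ_self
  rwa [coeff_residuePart, if_pos] at h
  rw [hN, Nat.cast_add, Nat.cast_mul, ZMod.natCast_self, zero_mul, zero_add]
  rfl
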